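/- arXiv:2501.10863 — 6 statements merged into one kernel-verified Lean document; each statement's English description precedes it below -/
import Mathlib

section
/- Let I = (0,0), A = (cos 216°, sin 216°), B = (cos 144°, sin 144°), C = (cos 72°, sin 72°), D = (cos 288°, sin 288°) in ℝ². Let E be the intersection point of the lines AB and ID, F the intersection point of the lines AB and IC, and H the intersection point of the lines IA and BC. Consider the ten lines IA, IB, IC, ID, AB, BC, AD, EC, FD, HE (these are pairwise distinct, and none of them is horizontal, so each admits a unique defining equation of the form x − bᵢ y − aᵢ = 0 with aᵢ, bᵢ ∈ ℝ). Then the product polynomial ∏ᵢ₌₁¹⁰ (X − bᵢ Y − aᵢ) does NOT have all its coefficients in ℚ. -/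
open Real MvPolynomial

/-- Three collinear points of the plane have vanishing cross product. -/
theorem Collinear.cross_eq {p q r : ℝ × ℝ} (h : Collinear ℝ ({p, q, r} : Set (ℝ × ℝ))) :
    (q.1 - p.1) * (r.2 - p.2) = (q.2 - p.2) * (r.1 - p.1) := by
  obtain ⟨v, hv⟩ := (collinear_iff_of_mem (p₀ := p) (by simp)).1 h
  obtain ⟨x, hx⟩ := hv q (by simp)
  obtain ⟨y, hy⟩ := hv r (by simp)
  simp only [hx, hy, vadd_eq_add, Prod.fst_add, Prod.snd_add, Prod.smul_fst, Prod.smul_snd,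
    smul_eq_mul]
  ring

section LinearFactors

variable {R : Type*} [CommRing R]

theorem coeff_linear_mul (a b : R) (p : MvPolynomial (Fin 2) R) (m : Fin 2 →₀ ℕ) :
    coeff m ((X 0 - C b * X 1 - C a) * p) =
      (if 0 ∈ m.support then coeff (m - Finsupp.single 0 1) p else 0) -
        b * (if 1 ∈ m.support then coeff (m - Finsupp.single 1 1) p else 0) -
        a * coeff m p := by
  rw [sub_mul, sub_mul, coeff_sub, coeff_sub, coeff_X_mul', mul_assoc, coeff_C_mul,
    coeff_X_mul', coeff_C_mul]

theorem coeff_linear_mul_pow (a b : R) (p : MvPolynomial (Fin 2) R) (k : ℕ) :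
    coeff (Finsupp.single 0 (k + 1)) ((X 0 - C b * X 1 - C a) * p) =
      coeff (Finsupp.single 0 k) p - a * coeff (Finsupp.single 0 (k + 1)) p := by
  simp [coeff_linear_mul]

theorem coeff_linear_mul_pow_mul (a b : R) (p : MvPolynomial (Fin 2) R) (k : ℕ) :
    coeff (Finsupp.single 0 (k + 1) + Finsupp.single 1 1) ((X 0 - C b * X 1 - C a) * p) =
      coeff (Finsupp.single 0 k + Finsupp.single 1 1) p -
        b * coeff (Finsupp.single 0 (k + 1)) p -
        a * coeff (Finsupp.single 0 (k + 1) + Finsupp.single 1 1) p := by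
  have h : (Finsupp.single 0 (k + 1) + Finsupp.single 1 1 - Finsupp.single 0 1 : Fin 2 →₀ ℕ) =
      Finsupp.single 0 k + Finsupp.single 1 1 := by
    rw [Finsupp.single_add, add_right_comm, add_tsub_cancel_right]
  rw [coeff_linear_mul, h]
  simp

theorem coeff_linear_mul_snd (a b : R) (p : MvPolynomial (Fin 2) R) :
    coeff (Finsupp.single 0 0 + Finsupp.single 1 1) ((X 0 - C b * X 1 - C a) * p) =
      - b * coeff (Finsupp.single 0 0) p -
        a * coeff (Finsupp.single 0 0 + Finsupp.single 1 1) p := by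
  simp [coeff_linear_mul]

theorem coeff_prod_linear_aux {ι : Type*} [DecidableEq ι] (a b : ι → R) (s : Finset ι) :
    (∀ k, s.card < k → coeff (Finsupp.single 0 k)
      (∏ i ∈ s, (X 0 - C (b i) * X 1 - C (a i) : MvPolynomial (Fin 2) R)) = 0) ∧
    coeff (Finsupp.single 0 s.card)
      (∏ i ∈ s, (X 0 - C (b i) * X 1 - C (a i) : MvPolynomial (Fin 2) R)) = 1 ∧
    (∀ k, s.card ≤ k → coeff (Finsupp.single 0 k + Finsupp.single 1 1)
      (∏ i ∈ s, (X 0 - C (b i) * X 1 - C (a i) : MvPolynomial (Fin 2) R)) = 0) ∧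
    ∀ k, k + 1 = s.card → coeff (Finsupp.single 0 k + Finsupp.single 1 1)
      (∏ i ∈ s, (X 0 - C (b i) * X 1 - C (a i) : MvPolynomial (Fin 2) R)) =
        - ∑ i ∈ s, b i := by
  induction s using Finset.induction_on with
  | empty =>
    refine ⟨fun k hk => ?_, by simp, fun k _ => ?_, fun k hk => by simp at hk⟩
    · have : k ≠ 0 := by simpa [Nat.pos_iff_ne_zero] using hk
      simp [coeff_one, eq_comm, this]
    · have : (Finsupp.single 0 k + Finsupp.single 1 1 : Fin 2 →₀ ℕ) ≠ 0 := fun h => by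
        simpa using DFunLike.congr_fun h 1
      simp [coeff_one, this.symm]
  | insert j s hj ih =>
    obtain ⟨h₁, h₂, h₃, h₄⟩ := ih
    simp only [Finset.prod_insert hj, Finset.card_insert_of_notMem hj, Finset.sum_insert hj]
    refine ⟨fun k hk => ?_, ?_, fun k hk => ?_, fun k hk => ?_⟩
    · obtain ⟨k, rfl⟩ := Nat.exists_eq_succ_of_ne_zero (by omega : k ≠ 0)
      rw [Nat.succ_eq_add_one, coeff_linear_mul_pow, h₁ k (by omega), h₁ (k + 1) (by omega)]
      ring
    · rw [coeff_linear_mul_pow, h₂, h₁ _ (by omega)]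
      ring
    · obtain ⟨k, rfl⟩ := Nat.exists_eq_succ_of_ne_zero (by omega : k ≠ 0)
      rw [Nat.succ_eq_add_one, coeff_linear_mul_pow_mul, h₃ k (by omega), h₁ (k + 1) (by omega),
        h₃ (k + 1) (by omega)]
      ring
    · obtain rfl : k = s.card := by omega
      rcases Nat.eq_zero_or_eq_succ_pred s.card with h | h
      · rw [h] at h₂
        rw [h, coeff_linear_mul_snd, h₂, h₃ 0 (by omega), Finset.card_eq_zero.1 h]
        simp
      · rw [h] at h₂
        rw [h, Nat.succ_eq_add_one, coeff_linear_mul_pow_mul, h₄ _ (by omega),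
          ← Nat.succ_eq_add_one, h₂, h₃ _ (by omega)]
        ring

/-- In a product of `n + 1` linear factors `X - bᵢ Y - aᵢ`, the coefficient of `XⁿY` is
`-∑ bᵢ`. -/
theorem coeff_prod_linear (n : ℕ) (a b : Fin (n + 1) → R) :
    coeff (Finsupp.single 0 n + Finsupp.single 1 1)
      (∏ i, (X 0 - C (b i) * X 1 - C (a i) : MvPolynomial (Fin 2) R)) = - ∑ i, b i :=
  (coeff_prod_linear_aux a b Finset.univ).2.2.2 n (by simp)

end LinearFactors

theorem cos_two_pi_div_five_eq : Real.cos (2 * π / 5) = (√5 - 1) / 4 := by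
  have h : (√5 : ℝ) ^ 2 = 5 := Real.sq_sqrt (by norm_num)
  rw [show 2 * π / 5 = 2 * (π / 5) by ring, Real.cos_two_mul, Real.cos_pi_div_five]
  linear_combination h / 8

theorem four_mul_cos_sq_add_two_mul_cos :
    4 * Real.cos (2 * π / 5) ^ 2 + 2 * Real.cos (2 * π / 5) = 1 := by
  have h : (√5 : ℝ) ^ 2 = 5 := Real.sq_sqrt (by norm_num)
  rw [cos_two_pi_div_five_eq]
  linear_combination h / 4

theorem irrational_cos_two_pi_div_five : Irrational (Real.cos (2 * π / 5)) := by
  have h : Irrational √5 := by exact_mod_cast Nat.Prime.irrational_sqrt (p := 5) (by norm_num)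
  rw [cos_two_pi_div_five_eq]
  exact_mod_cast (h.sub_ratCast 1).div_ratCast (q := 4) (by norm_num)

/-- `-tan 72°` is irrational. -/
theorem irrational_of_mul_cos_two_pi_div_five_eq {x : ℝ}
    (hx : x * Real.cos (2 * π / 5) = - Real.sin (2 * π / 5)) : Irrational x := by
  rintro ⟨q, rfl⟩
  have hc := four_mul_cos_sq_add_two_mul_cos
  have hs := Real.sin_sq_add_cos_sq (2 * π / 5)
  refine irrational_cos_two_pi_div_five ⟨(1 - 4 / (q ^ 2 + 1)) / 2, ?_⟩
  have hq : (q : ℝ) ^ 2 + 1 ≠ 0 := by positivity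
  push_cast
  field_simp
  linear_combination 4 * hs + 4 * (q * Real.cos (2 * π / 5) - Real.sin (2 * π / 5)) * hx -
    (q ^ 2 + 1) * hc

/-- The arrangement `𝒜′` of ten lines built on the regular pentagon:
`I = (0,0)`, `A, B, C, D` the primitive fifth roots of unity
(at angles `216°, 144°, 72°, 288°`), `E = AB ∩ ID`, `F = AB ∩ IC`, `H = IA ∩ BC`,
and the ten lines `IA, IB, IC, ID, AB, BC, AD, EC, FD, HE`, the `i`-th line given
by the equation `x − bᵢ y − aᵢ = 0`.  Then the product polynomial
`∏ᵢ (X − bᵢ Y − aᵢ)` does not have all of its coefficients rational. -/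
theorem pentagon_arrangement_not_rational
    (I A B C D E F H : ℝ × ℝ)
    (hI : I = (0, 0))
    (hA : A = (Real.cos (6 * π / 5), Real.sin (6 * π / 5)))
    (hB : B = (Real.cos (4 * π / 5), Real.sin (4 * π / 5)))
    (hC : C = (Real.cos (2 * π / 5), Real.sin (2 * π / 5)))
    (hD : D = (Real.cos (8 * π / 5), Real.sin (8 * π / 5)))
    (hE : Collinear ℝ ({A, B, E} : Set (ℝ × ℝ)) ∧ Collinear ℝ ({I, D, E} : Set (ℝ × ℝ)))
    (hF : Collinear ℝ ({A, B, F} : Set (ℝ × ℝ)) ∧ Collinear ℝ ({I, C, F} : Set (ℝ × ℝ)))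
    (hH : Collinear ℝ ({I, A, H} : Set (ℝ × ℝ)) ∧ Collinear ℝ ({B, C, H} : Set (ℝ × ℝ)))
    (P Q : Fin 10 → ℝ × ℝ)
    (hP : P = ![I, I, I, I, A, B, A, E, F, H])
    (hQ : Q = ![A, B, C, D, B, C, D, C, D, E])
    (a b : Fin 10 → ℝ)
    (hline : ∀ i : Fin 10, (P i).1 - b i * (P i).2 - a i = 0 ∧
      (Q i).1 - b i * (Q i).2 - a i = 0) :
    ¬ ∀ m : Fin 2 →₀ ℕ,
      (MvPolynomial.coeff m
        (∏ i : Fin 10,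
          (MvPolynomial.X 0 - MvPolynomial.C (b i) * MvPolynomial.X 1 -
            MvPolynomial.C (a i) : MvPolynomial (Fin 2) ℝ))) ∈
        Set.range ((↑) : ℚ → ℝ) := by
  have hc := four_mul_cos_sq_add_two_mul_cos
  have hs := Real.sin_sq_add_cos_sq (2 * π / 5)
  have hs0 : 0 < Real.sin (2 * π / 5) :=
    Real.sin_pos_of_pos_of_lt_pi (by positivity) (by linarith [Real.pi_pos])
  have hc0 : 0 < Real.cos (2 * π / 5) :=
    Real.cos_pos_of_mem_Ioo ⟨by linarith [Real.pi_pos], by linarith [Real.pi_pos]⟩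
  have c4 : Real.cos (4 * π / 5) = -1 / 2 - Real.cos (2 * π / 5) := by
    rw [show 4 * π / 5 = 2 * (2 * π / 5) by ring, Real.cos_two_mul]
    linear_combination hc / 2
  have s4 : Real.sin (4 * π / 5) = 2 * Real.sin (2 * π / 5) * Real.cos (2 * π / 5) := by
    rw [show 4 * π / 5 = 2 * (2 * π / 5) by ring, Real.sin_two_mul]
  have c6 : Real.cos (6 * π / 5) = -1 / 2 - Real.cos (2 * π / 5) := by
    rw [← c4, show 6 * π / 5 = 2 * π - 4 * π / 5 by ring, Real.cos_two_pi_sub]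
  have s6 : Real.sin (6 * π / 5) = -(2 * Real.sin (2 * π / 5) * Real.cos (2 * π / 5)) := by
    rw [← s4, show 6 * π / 5 = 2 * π - 4 * π / 5 by ring, Real.sin_two_pi_sub]
  have c8 : Real.cos (8 * π / 5) = Real.cos (2 * π / 5) := by
    rw [show 8 * π / 5 = 2 * π - 2 * π / 5 by ring, Real.cos_two_pi_sub]
  have s8 : Real.sin (8 * π / 5) = - Real.sin (2 * π / 5) := by
    rw [show 8 * π / 5 = 2 * π - 2 * π / 5 by ring, Real.sin_two_pi_sub]
  have tan_irr (x : ℝ) := irrational_of_mul_cos_two_pi_div_five_eq (x := x)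
  rw [c6, s6] at hA
  rw [c4, s4] at hB
  rw [c8, s8] at hD
  generalize Real.cos (2 * π / 5) = c at *
  generalize Real.sin (2 * π / 5) = s at *
  have E₁ := hE.1.cross_eq
  have E₂ := hE.2.cross_eq
  have F₁ := hF.1.cross_eq
  have F₂ := hF.2.cross_eq
  have H₁ := hH.1.cross_eq
  have H₂ := hH.2.cross_eq
  clear hE hF hH
  obtain ⟨e₁, e₂⟩ := E
  obtain ⟨f₁, f₂⟩ := F
  obtain ⟨h₁, h₂⟩ := H
  subst hI hA hB hC hD hP hQ
  simp only [sub_zero, sub_self, zero_mul] at E₁ E₂ F₁ F₂ H₁ H₂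
  have hcs : c * s ≠ 0 := by positivity
  obtain rfl : e₁ = -1 / 2 - c := mul_left_cancel₀ hcs (by linear_combination -E₁ / 4)
  obtain rfl : f₁ = -1 / 2 - c := mul_left_cancel₀ hcs (by linear_combination -F₁ / 4)
  obtain rfl : e₂ = s * (2 + 2 * c) :=
    mul_left_cancel₀ hc0.ne' (by linear_combination E₂ - s / 2 * hc)
  obtain rfl : f₂ = - (s * (2 + 2 * c)) :=
    mul_left_cancel₀ hc0.ne' (by linear_combination F₂ + s / 2 * hc)
  obtain rfl : h₂ = (2 - 4 * c) * s * h₁ := by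
    refine mul_left_cancel₀ (by positivity : 1 / 2 + c ≠ 0) ?_
    linear_combination -H₁ + s * h₁ * hc
  obtain rfl : h₁ = 2 * c + 3 / 2 := by
    have h : 0 < 8 * c - 2 := by nlinarith
    refine mul_left_cancel₀ (by positivity : s * (8 * c - 2) ≠ 0) ?_
    linear_combination H₂ + s * (2 * h₁ - 7 / 2) * hc
  have l0 := hline 0
  have l1 := hline 1
  have l2 := hline 2
  have l3 := hline 3
  have l4 := hline 4
  have l5 := hline 5
  have l6 := hline 6
  have l7 := hline 7
  have l8 := hline 8
  have l9 := hline 9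
  simp at l0 l1 l2 l3 l4 l5 l6 l7 l8 l9
  have b01 : b 0 + b 1 = 0 := mul_left_cancel₀ hcs (by
    linear_combination (l0.2 + l0.1 - l1.2 - l1.1) / 2)
  have b23 : b 2 + b 3 = 0 := mul_left_cancel₀ hs0.ne' (by
    linear_combination l3.2 + l3.1 - l2.2 - l2.1)
  have b4 : b 4 = 0 := mul_left_cancel₀ hcs (by linear_combination (l4.1 - l4.2) / 4)
  have b56 : b 5 + b 6 = 0 := by
    refine mul_left_cancel₀ (a := s * (1 - 2 * c)) ?_ ?_
    · have : 0 < 1 - 2 * c := by nlinarith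
      positivity
    · linear_combination l5.1 - l5.2 + l6.2 - l6.1
  have b78 : b 7 + b 8 = 0 := by
    refine mul_left_cancel₀ (by positivity : s * (1 + 2 * c) ≠ 0) ?_
    linear_combination l7.2 - l7.1 - l8.2 + l8.1
  have b9 : b 9 * c = - s := by
    refine mul_left_cancel₀ hs0.ne' ?_
    linear_combination c * (l9.1 - l9.2) - 2 * c * b 9 * s * hc + hs - hc
  intro hrat
  obtain ⟨q, hq⟩ := hrat (Finsupp.single 0 9 + Finsupp.single 1 1)
  refine tan_irr (b 9) b9 ⟨-q, ?_⟩
  rw [coeff_prod_linear 9 a b] at hq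
  have hsum : ∑ i, b i = b 0 + b 1 + b 2 + b 3 + b 4 + b 5 + b 6 + b 7 + b 8 + b 9 := by
    simp [Fin.sum_univ_castSucc]
  push_cast
  linear_combination -hq + hsum + b01 + b23 + b4 + b56 + b78
end

section
/- Let n ≥ 1, let N ≥ 2 be an integer, let c > 0, and let f, g : ℂⁿ → ℂ be differentiable functions with g(w) = f(w) + wₙᴺ for all w (where wₙ is the last coordinate), so that ∇g(x) = ∇f(x) + N·xₙ^{N−1}·eₙ. Suppose x ∈ ℂⁿ satisfies ∇f(x) ≠ 0, ‖∇f(x)‖ ≥ c·|xₙ|^{N−2}, and |xₙ| ≤ c/(2N). Then ∇g(x) ≠ 0 and ‖ ∇f(x)/‖∇f(x)‖ − ∇g(x)/‖∇g(x)‖ ‖ ≤ (4N/c)·|xₙ|. -/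
/-- The vector of complex partial derivatives of `f : ℂⁿ → ℂ` at `x`. -/
noncomputable def cgrad {n : ℕ} (f : EuclideanSpace ℂ (Fin n) → ℂ)
    (x : EuclideanSpace ℂ (Fin n)) : EuclideanSpace ℂ (Fin n) :=
  (WithLp.equiv 2 (Fin n → ℂ)).symm fun i => fderiv ℂ f x (EuclideanSpace.single i 1)

theorem norm_inv_smul_sub_inv_smul_le {E : Type*} [NormedAddCommGroup E] [NormedSpace ℝ E]
    {a b : E} (ha : a ≠ 0) (hb : b ≠ 0) :
    ‖‖a‖⁻¹ • a - ‖b‖⁻¹ • b‖ ≤ 2 * ‖a - b‖ / ‖a‖ := by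
  have ha' : 0 < ‖a‖ := norm_pos_iff.2 ha
  have hb' : 0 < ‖b‖ := norm_pos_iff.2 hb
  have hdecomp : ‖a‖⁻¹ • a - ‖b‖⁻¹ • b = ‖a‖⁻¹ • ((a - b) + (‖b‖ - ‖a‖) • (‖b‖⁻¹ • b)) := by
    match_scalars <;> field_simp
    ring
  have hunit : ‖‖b‖⁻¹ • b‖ = 1 := by
    rw [norm_smul, norm_inv, norm_norm, inv_mul_cancel₀ hb'.ne']
  have hrev : ‖‖b‖ - ‖a‖‖ ≤ ‖a - b‖ := by
    rw [norm_sub_rev a b]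
    exact abs_norm_sub_norm_le b a
  rw [hdecomp, norm_smul, norm_inv, norm_norm, inv_mul_eq_div]
  gcongr
  calc ‖(a - b) + (‖b‖ - ‖a‖) • (‖b‖⁻¹ • b)‖
      ≤ ‖a - b‖ + ‖‖b‖ - ‖a‖‖ * ‖‖b‖⁻¹ • b‖ := by
        rw [← norm_smul]
        exact norm_add_le _ _
    _ ≤ 2 * ‖a - b‖ := by
        rw [hunit]
        linarith

theorem cgrad_add_coord_pow {n : ℕ} {f g : EuclideanSpace ℂ (Fin n) → ℂ} {j : Fin n} {N : ℕ}
    {x : EuclideanSpace ℂ (Fin n)} (hf : DifferentiableAt ℂ f x)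
    (hfg : ∀ w, g w = f w + w j ^ N) :
    cgrad g x = cgrad f x + EuclideanSpace.single j (N * x j ^ (N - 1)) := by
  have hcoord : HasFDerivAt (fun w : EuclideanSpace ℂ (Fin n) => w j)
      (EuclideanSpace.proj j : EuclideanSpace ℂ (Fin n) →L[ℂ] ℂ) x :=
    (EuclideanSpace.proj j : EuclideanSpace ℂ (Fin n) →L[ℂ] ℂ).hasFDerivAt
  have hderiv := hf.hasFDerivAt.add (hcoord.pow N)
  rw [show g = f + fun w => w j ^ N from funext hfg]
  ext i
  by_cases hij : j = i
  · subst hij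
    simp [cgrad, hderiv.fderiv]
  · simp [cgrad, hderiv.fderiv, hij, Ne.symm hij]

/-- If `g(w) = f(w) + wₙᴺ`, `∇f(x) ≠ 0`, `‖∇f(x)‖ ≥ c·|xₙ|^{N−2}` and
`|xₙ| ≤ c/(2N)`, then `∇g(x) ≠ 0` and the normalized gradients of `f` and `g`
at `x` differ by at most `(4N/c)·|xₙ|`. -/
theorem normalized_gradient_estimate (n : ℕ) (hn : 1 ≤ n) (N : ℕ) (hN : 2 ≤ N)
    (c : ℝ) (hc : 0 < c)
    (f g : EuclideanSpace ℂ (Fin n) → ℂ)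
    (hf : Differentiable ℂ f) (hg : Differentiable ℂ g)
    (hfg : ∀ w, g w = f w + (w ⟨n - 1, by omega⟩) ^ N)
    (x : EuclideanSpace ℂ (Fin n))
    (h1 : cgrad f x ≠ 0)
    (h2 : c * ‖x ⟨n - 1, by omega⟩‖ ^ (N - 2) ≤ ‖cgrad f x‖)
    (h3 : ‖x ⟨n - 1, by omega⟩‖ ≤ c / (2 * N)) :
    cgrad g x ≠ 0 ∧
      ‖‖cgrad f x‖⁻¹ • cgrad f x - ‖cgrad g x‖⁻¹ • cgrad g x‖ ≤
        (4 * N / c) * ‖x ⟨n - 1, by omega⟩‖ := by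
  set j : Fin n := ⟨n - 1, by omega⟩
  set r := ‖x j‖
  have hr : 0 ≤ r := norm_nonneg _
  have ha : 0 < ‖cgrad f x‖ := norm_pos_iff.2 h1
  have hN' : (0 : ℝ) < N := by positivity
  have hdist : ‖cgrad f x - cgrad g x‖ = N * r * r ^ (N - 2) := by
    rw [cgrad_add_coord_pow (hf x) hfg, sub_add_cancel_left, norm_neg, PiLp.norm_single, norm_mul,
      norm_pow, Complex.norm_natCast, mul_assoc, ← pow_succ']
    congr 3
    omega
  have hdist_le : ‖cgrad f x - cgrad g x‖ ≤ N * r / c * ‖cgrad f x‖ := by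
    calc ‖cgrad f x - cgrad g x‖ = N * r / c * (c * r ^ (N - 2)) := by
          rw [hdist]
          field_simp
      _ ≤ N * r / c * ‖cgrad f x‖ := by gcongr
  have hhalf : N * r / c ≤ 1 / 2 := by
    rw [le_div_iff₀ (by positivity)] at h3
    rw [div_le_iff₀ hc]
    linarith
  have hb : cgrad g x ≠ 0 := by
    intro h
    rw [h, sub_zero] at hdist_le
    nlinarith
  refine ⟨hb, (norm_inv_smul_sub_inv_smul_le h1 hb).trans ?_⟩
  rw [div_le_iff₀ ha]
  have hnonneg : 0 ≤ N * r / c * ‖cgrad f x‖ := by positivity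
  calc 2 * ‖cgrad f x - cgrad g x‖ ≤ 4 * (N * r / c * ‖cgrad f x‖) := by linarith
    _ = 4 * N / c * r * ‖cgrad f x‖ := by ring
end

section
/- Let F : ℂ⁴ → ℂ be the polynomial F(x,y,z,t) = z(zx − y² + tx³). Every point (x,y,z,t) ∈ ℂ⁴ at which the three partial derivatives ∂F/∂x = z² + 3tzx², ∂F/∂y = −2yz, and ∂F/∂z = 2zx − y² + tx³ all vanish satisfies F(x,y,z,t) = 0. (In other words, the relative polar curve, the closure of {∂F/∂x = ∂F/∂y = ∂F/∂z = 0, F ≠ 0}, is empty.) -/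
/-- For `F(x,y,z,t) = z(zx − y² + tx³)`, every point where the three partial
derivatives `∂F/∂x = z² + 3tzx²`, `∂F/∂y = −2yz`, `∂F/∂z = 2zx − y² + tx³`
vanish satisfies `F = 0`: the relative polar curve, the closure of
`{∂F/∂x = ∂F/∂y = ∂F/∂z = 0, F ≠ 0}`, is empty. -/
theorem relative_polar_curve_empty :
    ∀ x y z t : ℂ,
      (z ^ 2 + 3 * t * z * x ^ 2 = 0 ∧ -(2 * y * z) = 0 ∧
        2 * z * x - y ^ 2 + t * x ^ 3 = 0) →
      z * (z * x - y ^ 2 + t * x ^ 3) = 0 := by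
  rintro x y z t ⟨hx, hy, hz⟩
  linear_combination (2 / 5 * z) * hz + (3 / 10 * y) * hy + (x / 5) * hx
end

section
/- Let F : ℂ⁴ → ℂ be the polynomial F(x,y,z,t) = z(zx − y² + tx³). Fix α₁, α₂, α₃, β₃, γ ∈ ℂ and define, for s ∈ ℂ, the curve p(s) = (s, γs³, α₁s³ + α₂s⁴ + α₃s⁵, −2α₁s − 2α₂s² + β₃s³). Then, as s → 0 (s ≠ 0), s⁻⁶·(∂F/∂x, ∂F/∂y, ∂F/∂z, ∂F/∂t)(p(s)) converges to (−5α₁², −2α₁γ, 2α₃ + β₃ − γ², α₁). -/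
/-- For `F(x,y,z,t) = z(zx − y² + tx³)` and the curve
`p(s) = (s, γs³, α₁s³ + α₂s⁴ + α₃s⁵, −2α₁s − 2α₂s² + β₃s³)`, the rescaled
gradient `s⁻⁶·(∂F/∂x, ∂F/∂y, ∂F/∂z, ∂F/∂t)(p(s))` converges, as `s → 0`
(`s ≠ 0`), to `(−5α₁², −2α₁γ, 2α₃ + β₃ − γ², α₁)`. -/
theorem gradient_limit_along_curve (α₁ α₂ α₃ β₃ γ : ℂ) :
    Filter.Tendsto (fun s : ℂ =>
      ((s ^ 6)⁻¹ * ((α₁ * s ^ 3 + α₂ * s ^ 4 + α₃ * s ^ 5) ^ 2 +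
          3 * (-2 * α₁ * s - 2 * α₂ * s ^ 2 + β₃ * s ^ 3) *
            (α₁ * s ^ 3 + α₂ * s ^ 4 + α₃ * s ^ 5) * s ^ 2),
       (s ^ 6)⁻¹ * (-(2 * (γ * s ^ 3) * (α₁ * s ^ 3 + α₂ * s ^ 4 + α₃ * s ^ 5))),
       (s ^ 6)⁻¹ * (2 * (α₁ * s ^ 3 + α₂ * s ^ 4 + α₃ * s ^ 5) * s - (γ * s ^ 3) ^ 2 +
          (-2 * α₁ * s - 2 * α₂ * s ^ 2 + β₃ * s ^ 3) * s ^ 3),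
       (s ^ 6)⁻¹ * ((α₁ * s ^ 3 + α₂ * s ^ 4 + α₃ * s ^ 5) * s ^ 3)))
      (nhdsWithin 0 {0}ᶜ)
      (nhds (-5 * α₁ ^ 2, -2 * α₁ * γ, 2 * α₃ + β₃ - γ ^ 2, α₁)) := by
  have h_cont : Continuous fun s : ℂ =>
      ((α₁ + α₂ * s + α₃ * s ^ 2) ^ 2 +
          3 * (-2 * α₁ - 2 * α₂ * s + β₃ * s ^ 2) * (α₁ + α₂ * s + α₃ * s ^ 2),
        -(2 * γ * (α₁ + α₂ * s + α₃ * s ^ 2)),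
        2 * α₃ + β₃ - γ ^ 2,
        α₁ + α₂ * s + α₃ * s ^ 2) := by
    fun_prop
  have h_lim := (h_cont.tendsto 0).mono_left (nhdsWithin_le_nhds (s := {0}ᶜ))
  refine (h_lim.congr' ?_).trans (le_of_eq ?_)
  · filter_upwards [self_mem_nhdsWithin] with s hs
    have hs : s ≠ 0 := hs
    simp only [Prod.mk.injEq]
    refine ⟨?_, ?_, ?_, ?_⟩ <;> field_simp <;> ring
  · congr 1
    simp only [Prod.mk.injEq, mul_zero, zero_pow two_ne_zero, add_zero, and_true]
    refine ⟨?_, ?_⟩ <;> ring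
end

section
/- Let F : ℂ⁴ → ℂ be the polynomial F(x,y,z,t) = z(zx − y² + tx³) and let ∇F = (∂F/∂x, ∂F/∂y, ∂F/∂z, ∂F/∂t). Then every direction in ℙ³ is a limit at the origin of the projectivised gradient of F: for every nonzero vector v ∈ ℂ⁴ there exist a sequence of points pₙ ∈ ℂ⁴ \ {0} with pₙ → 0 and ∇F(pₙ) ≠ 0, and scalars λₙ ∈ ℂ, such that λₙ·∇F(pₙ) → v. -/
/-- The gradient `∇F = (z² + 3tzx², −2yz, 2zx − y² + tx³, zx³)` of
`F(x,y,z,t) = z(zx − y² + tx³)`, with coordinates `q = (x, y, z, t)`. -/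
noncomputable def gradF (q : ℂ × ℂ × ℂ × ℂ) : ℂ × ℂ × ℂ × ℂ :=
  (q.2.2.1 ^ 2 + 3 * q.2.2.2 * q.2.2.1 * q.1 ^ 2,
   -(2 * q.2.1 * q.2.2.1),
   2 * q.2.2.1 * q.1 - q.2.1 ^ 2 + q.2.2.2 * q.1 ^ 3,
   q.2.2.1 * q.1 ^ 3)

/-- A vector whose first and last coordinates do not vanish is a multiple of `gradF q` for
points `q` arbitrarily close to the origin. -/
theorem exists_smul_gradF_eq {a b c d : ℂ} (ha : a ≠ 0) (hd : d ≠ 0)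
    {U : Set (ℂ × ℂ × ℂ × ℂ)} (hU : U ∈ nhds 0) :
    ∃ q ∈ U, q ≠ 0 ∧ gradF q ≠ 0 ∧ ∃ l : ℂ, l • gradF q = (a, b, c, d) := by
  let τ : ℂ → ℂ := fun x =>
    (2 * (a / d) - x ^ 2 * (a / d * (c / d) + (b / d) ^ 2 / 4)) / (5 - 3 * (c / d) * x ^ 2)
  let Q : ℂ → ℂ × ℂ × ℂ × ℂ := fun x =>
    (x, -(b / d * x ^ 3 / 2), (a / d - 3 * τ x) * x ^ 3, x * τ x)
  have hden : ContinuousAt (fun x : ℂ => 5 - 3 * (c / d) * x ^ 2) 0 := by fun_prop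
  have hτ : ContinuousAt τ 0 := by
    refine ContinuousAt.div (by fun_prop) hden (by norm_num)
  have hw : ContinuousAt (fun x => a / d - 3 * τ x) 0 := by fun_prop
  have hQ : ContinuousAt Q 0 := by fun_prop
  have hw_zero : a / d - 3 * τ 0 ≠ 0 := by
    have h : a / d - 3 * τ 0 = -(a / d) / 5 := by
      simp only [τ]
      ring
    rw [h]
    exact div_ne_zero (neg_ne_zero.mpr (div_ne_zero ha hd)) (by norm_num)
  have hQ_mem : ∀ᶠ x in nhds 0, Q x ∈ U := by
    refine hQ.eventually ?_
    have h : Q 0 = 0 := by simp [Q]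
    rwa [h]
  have hne : ∀ᶠ x : ℂ in nhdsWithin 0 {0}ᶜ, x ≠ 0 := eventually_mem_nhdsWithin
  have hden_ne : ∀ᶠ x : ℂ in nhds 0, 5 - 3 * (c / d) * x ^ 2 ≠ 0 :=
    hden.eventually_ne (by norm_num)
  obtain ⟨x, hx, hxU, hxden, hxw⟩ := (hne.and <| ((hQ_mem.and <|
    hden_ne.and (hw.eventually_ne hw_zero)).filter_mono
      nhdsWithin_le_nhds)).exists
  have hτx : τ x * (5 - 3 * (c / d) * x ^ 2) =
      2 * (a / d) - x ^ 2 * (a / d * (c / d) + (b / d) ^ 2 / 4) := div_mul_cancel₀ _ hxden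
  have hgrad : gradF (Q x) = ((a / d - 3 * τ x) * x ^ 6 / d) • (a, b, c, d) := by
    simp only [gradF, Q, Prod.smul_mk, smul_eq_mul, Prod.mk.injEq]
    refine ⟨by ring, by ring, ?_, ?_⟩
    · linear_combination (-x ^ 4) * hτx
    · field_simp
  have hs : (a / d - 3 * τ x) * x ^ 6 / d ≠ 0 :=
    div_ne_zero (mul_ne_zero hxw (pow_ne_zero _ hx)) hd
  refine ⟨Q x, hxU, fun h => hx (congrArg Prod.fst h), ?_, ((a / d - 3 * τ x) * x ^ 6 / d)⁻¹, ?_⟩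
  · rw [hgrad]
    exact smul_ne_zero hs fun h => ha (congrArg Prod.fst h)
  · rw [hgrad, inv_smul_smul₀ hs]

/-- Every direction of `ℙ³` is a limit at the origin of the projectivised
gradient of `F(x,y,z,t) = z(zx − y² + tx³)`: for every `v ≠ 0` there are points
`pₙ ≠ 0` tending to `0` with `∇F(pₙ) ≠ 0` and scalars `λₙ` with
`λₙ·∇F(pₙ) → v`. -/
theorem projectivised_gradient_limits_everything (v : ℂ × ℂ × ℂ × ℂ) (hv : v ≠ 0) :
    ∃ (q : ℕ → ℂ × ℂ × ℂ × ℂ) (lam : ℕ → ℂ),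
      (∀ n, q n ≠ 0) ∧ (∀ n, gradF (q n) ≠ 0) ∧
      Filter.Tendsto q Filter.atTop (nhds 0) ∧
      Filter.Tendsto (fun n => lam n • gradF (q n)) Filter.atTop (nhds v) := by
  obtain ⟨a, b, c, d⟩ := v
  have key : ∀ n : ℕ, ∃ (q : ℂ × ℂ × ℂ × ℂ) (l : ℂ), q ≠ 0 ∧ gradF q ≠ 0 ∧
      dist q 0 < 1 / ((n : ℝ) + 1) ∧
      dist (l • gradF q) (a, b, c, d) < 1 / ((n : ℝ) + 1) := by
    intro n
    have hε : 0 < 1 / ((n : ℝ) + 1) := Nat.one_div_pos_of_nat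
    obtain ⟨a', ha', haa'⟩ := (dense_compl_singleton (0 : ℂ)).exists_dist_lt a hε
    obtain ⟨d', hd', hdd'⟩ := (dense_compl_singleton (0 : ℂ)).exists_dist_lt d hε
    obtain ⟨q, hqU, hq, hgrad, l, hl⟩ :=
      exists_smul_gradF_eq (b := b) (c := c) ha' hd' (Metric.ball_mem_nhds 0 hε)
    refine ⟨q, l, hq, hgrad, hqU, ?_⟩
    rw [hl, dist_comm]
    simp only [Prod.dist_eq, dist_self, max_lt_iff]
    exact ⟨haa', hε, hε, hdd'⟩
  choose q lam hq hgrad hq_dist hdist using key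
  refine ⟨q, lam, hq, hgrad, ?_, ?_⟩ <;> rw [tendsto_iff_dist_tendsto_zero]
  · exact squeeze_zero (fun _ => dist_nonneg) (fun n => (hq_dist n).le)
      tendsto_one_div_add_atTop_nhds_zero_nat
  · exact squeeze_zero (fun _ => dist_nonneg) (fun n => (hdist n).le)
      tendsto_one_div_add_atTop_nhds_zero_nat
end

section
/- Let F : ℂ⁴ → ℂ be the polynomial F(x,y,z,t) = z(zx − y² + tx³) and let ∇F = (∂F/∂x, ∂F/∂y, ∂F/∂z, ∂F/∂t). Let pₙ be a sequence of points of ℂ⁴ with F(pₙ) = 0 and ∇F(pₙ) ≠ 0 for all n, with pₙ → 0, and suppose that the normalized gradients ∇F(pₙ)/‖∇F(pₙ)‖ converge to a vector η = (η₁, η₂, η₃, η₄) ∈ ℂ⁴. Then η₄ = 0 and 4η₁η₃ = η₂². -/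
/-- `F(x,y,z,t) = z(zx − y² + tx³)` on `ℂ⁴`, coordinates `q 0 = x`, `q 1 = y`,
`q 2 = z`, `q 3 = t`. -/
noncomputable def Fpol (q : EuclideanSpace ℂ (Fin 4)) : ℂ :=
  q 2 * (q 2 * q 0 - q 1 ^ 2 + q 3 * q 0 ^ 3)

/-- The gradient `∇F = (z² + 3tzx², −2yz, 2zx − y² + tx³, zx³)` of `Fpol`,
as an element of `ℂ⁴` with the Euclidean (Hermitian) norm. -/
noncomputable def gradFpol (q : EuclideanSpace ℂ (Fin 4)) : EuclideanSpace ℂ (Fin 4) :=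
  (WithLp.equiv 2 (Fin 4 → ℂ)).symm
    ![q 2 ^ 2 + 3 * q 3 * q 2 * q 0 ^ 2,
      -(2 * q 1 * q 2),
      2 * q 2 * q 0 - q 1 ^ 2 + q 3 * q 0 ^ 3,
      q 2 * q 0 ^ 3]

open Filter Topology

theorem norm_gradFpol_three_le {q : EuclideanSpace ℂ (Fin 4)} (hq : Fpol q = 0) :
    ‖gradFpol q 3‖ ≤ ‖q 0 ^ 2‖ * ‖gradFpol q 2‖ := by
  rw [← norm_mul]
  rcases mul_eq_zero.mp hq with hz | hz
  · simp [gradFpol, hz]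
    positivity
  · refine le_of_eq (congrArg norm ?_)
    simp only [gradFpol, WithLp.equiv_symm_apply, PiLp.toLp_apply, Matrix.cons_val]
    linear_combination -q 0 ^ 2 * hz

theorem norm_discriminant_gradFpol_le {q : EuclideanSpace ℂ (Fin 4)} (hq : Fpol q = 0) :
    ‖4 * gradFpol q 0 * gradFpol q 2 - gradFpol q 1 ^ 2‖ ≤
      ‖8 * q 3 * q 0‖ * ‖gradFpol q 2 ^ 2‖ := by
  rw [← norm_mul]
  rcases mul_eq_zero.mp hq with hz | hz
  · simp only [gradFpol, WithLp.equiv_symm_apply, PiLp.toLp_apply, Matrix.cons_val, hz]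
    simp
    positivity
  · refine le_of_eq (congrArg norm ?_)
    have h2 : gradFpol q 2 = q 2 * q 0 := by
      simp only [gradFpol, WithLp.equiv_symm_apply, PiLp.toLp_apply, Matrix.cons_val]
      linear_combination hz
    rw [h2]
    simp only [gradFpol, WithLp.equiv_symm_apply, PiLp.toLp_apply, Matrix.cons_val]
    linear_combination 4 * q 2 ^ 2 * hz

/-- If points `pₙ` of the hypersurface `{F = 0}`, with `∇F(pₙ) ≠ 0`, tend to the
origin and the normalized gradients `∇F(pₙ)/‖∇F(pₙ)‖` converge to
`η = (η₁, η₂, η₃, η₄)`, then `η₄ = 0` and `4η₁η₃ = η₂²`. -/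
theorem limits_of_tangent_hyperplanes
    (p : ℕ → EuclideanSpace ℂ (Fin 4))
    (hF : ∀ n, Fpol (p n) = 0)
    (hgrad : ∀ n, gradFpol (p n) ≠ 0)
    (hp : Filter.Tendsto p Filter.atTop (nhds 0))
    (η : EuclideanSpace ℂ (Fin 4))
    (hη : Filter.Tendsto (fun n => (‖gradFpol (p n)‖⁻¹ : ℝ) • gradFpol (p n))
      Filter.atTop (nhds η)) :
    η 3 = 0 ∧ 4 * η 0 * η 2 = η 1 ^ 2 := by
  have hcoord (i : Fin 4) : Tendsto (fun n => p n i) atTop (𝓝 0) :=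
    ((PiLp.continuous_apply 2 _ i).tendsto 0).comp hp
  have hlim (i : Fin 4) :
      Tendsto (fun n => ((‖gradFpol (p n)‖⁻¹ : ℝ) : ℂ) * gradFpol (p n) i) atTop (𝓝 (η i)) := by
    simpa [Function.comp_def] using ((PiLp.continuous_apply 2 _ i).tendsto η).comp hη
  constructor
  · have hbound : Tendsto (fun n => ‖p n 0 ^ 2‖ *
        ‖((‖gradFpol (p n)‖⁻¹ : ℝ) : ℂ) * gradFpol (p n) 2‖) atTop (𝓝 0) := by
      simpa using ((hcoord 0).pow 2).norm.mul (hlim 2).norm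
    refine tendsto_nhds_unique (hlim 3) (squeeze_zero_norm (fun n => ?_) hbound)
    rw [norm_mul, norm_mul, mul_left_comm]
    exact mul_le_mul_of_nonneg_left (norm_gradFpol_three_le (hF n)) (norm_nonneg _)
  · have hbound : Tendsto (fun n => ‖8 * p n 3 * p n 0‖ *
        ‖(((‖gradFpol (p n)‖⁻¹ : ℝ) : ℂ) * gradFpol (p n) 2) ^ 2‖) atTop (𝓝 0) := by
      simpa using (((hcoord 3).const_mul 8).mul (hcoord 0)).norm.mul ((hlim 2).pow 2).norm
    refine sub_eq_zero.mp (tendsto_nhds_unique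
      ((((hlim 0).const_mul 4).mul (hlim 2)).sub ((hlim 1).pow 2))
      (squeeze_zero_norm (fun n => ?_) hbound))
    set c : ℂ := ((‖gradFpol (p n)‖⁻¹ : ℝ) : ℂ)
    calc _ = ‖c ^ 2‖ * ‖4 * gradFpol (p n) 0 * gradFpol (p n) 2 - gradFpol (p n) 1 ^ 2‖ := by
          rw [← norm_mul]; congr 1; ring
      _ ≤ ‖c ^ 2‖ * (‖8 * p n 3 * p n 0‖ * ‖gradFpol (p n) 2 ^ 2‖) :=
          mul_le_mul_of_nonneg_left (norm_discriminant_gradFpol_le (hF n)) (norm_nonneg _)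
      _ = _ := by rw [mul_pow, norm_mul (c ^ 2), mul_left_comm]
end
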